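/- Let w be a nonempty finite word with heart v. If |w| + 2 = R_v + K_v + |Alph(w)|, then min{R_v, K_v} = min{L_v, H_v} and |w| + 2 = L_v + H_v + |Alph(w)|. -/

import Mathlib

open List

variable {A : Type*} [DecidableEq A]

/-- The alphabet of a word: the finite set of distinct letters occurring in it. -/
def Alph (w : List A) : Finset A := w.toFinset

/-- The finset of all factors (contiguous subwords) of `w`. -/
def factors (w : List A) : Finset (List A) :=
  ((Finset.range (w.length + 1)) ×ˢ (Finset.range (w.length + 1))).image
    (fun p => (w.drop p.1).take p.2)

/-- Factor complexity: the number of distinct factors of `w` of length `n`. -/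
def C (w : List A) (n : ℕ) : ℕ := ((factors w).filter (fun u => u.length = n)).card

/-- Right-valence of `u` in `w`: the number of distinct letters `x` such that `u ++ [x]`
is a factor of `w`. -/
def rightValence (w u : List A) : ℕ := ((Alph w).filter (fun x => u ++ [x] <:+: w)).card

/-- `u` is a right special factor of `w`. -/
def RightSpecial (w u : List A) : Prop := u <:+: w ∧ 2 ≤ rightValence w u

/-- `R w`: the smallest positive integer `r` such that `w` has no right special factor
of length `r`. -/
noncomputable def R (w : List A) : ℕ :=
  sInf {r : ℕ | 0 < r ∧ ∀ u : List A, u.length = r → ¬ RightSpecial w u}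

/-- The number of occurrences of `u` as a factor of `w`. -/
def occCount (w u : List A) : ℕ :=
  ((Finset.range (w.length + 1)).filter
    (fun i => i + u.length ≤ w.length ∧ (w.drop i).take u.length = u)).card

/-- `K w`: the length of the shortest suffix of `w` occurring exactly once in `w`. -/
noncomputable def K (w : List A) : ℕ :=
  sInf {k : ℕ | ∃ u : List A, u <:+ w ∧ u.length = k ∧ occCount w u = 1}

/-- Left-valence of `u` in `w`. -/
def leftValence (w u : List A) : ℕ := ((Alph w).filter (fun x => x :: u <:+: w)).card

/-- `u` is a left special factor of `w`. -/
def LeftSpecial (w u : List A) : Prop := u <:+: w ∧ 2 ≤ leftValence w u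

/-- `L w`: the smallest positive integer `ℓ` such that `w` has no left special factor
of length `ℓ`. -/
noncomputable def L (w : List A) : ℕ :=
  sInf {r : ℕ | 0 < r ∧ ∀ u : List A, u.length = r → ¬ LeftSpecial w u}

/-- `H w`: the length of the shortest prefix of `w` occurring exactly once in `w`. -/
noncomputable def H (w : List A) : ℕ :=
  sInf {k : ℕ | ∃ u : List A, u <+: w ∧ u.length = k ∧ occCount w u = 1}

/-- A generalized trapezoidal word. -/
def IsGT (w : List A) : Prop :=
  w ≠ [] ∧ ((Alph w).card = 1 ∨
    ∃ m M : ℕ, 0 < m ∧ m ≤ M ∧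
      (∀ i, 1 ≤ i → i ≤ m → C w i = (Alph w).card + i - 1) ∧
      (∀ i, m ≤ i → i ≤ M - 1 → C w (i + 1) = C w i) ∧
      (∀ i, M ≤ i → i ≤ w.length → C w (i + 1) = C w i - 1))

/-- The heart of a word: remove the longest prefix and longest suffix consisting of
letters that occur exactly once in the word (if some letter repeats); otherwise the
word itself. -/
def heart (w : List A) : List A :=
  if ∀ x ∈ w, w.count x = 1 then w
  else
    ((w.dropWhile (fun x => w.count x == 1)).reverse.dropWhile
      (fun x => w.count x == 1)).reverse

/-- A word is rich if it has exactly `|w| + 1` distinct palindromic factors. -/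
def Rich (w : List A) : Prop :=
  ((factors w).filter (fun u => u.reverse = u)).card = w.length + 1

/-- `p` is a period of `w`. -/
def IsPeriod (w : List A) (p : ℕ) : Prop :=
  0 < p ∧ ∀ i : ℕ, i + p < w.length → w[i]? = w[i + p]?

/-- The minimal period of `w`. -/
noncomputable def minPeriod (w : List A) : ℕ := sInf {p : ℕ | IsPeriod w p}


lemma mem_factors' (w u : List A) : u ∈ factors w ↔ u <:+: w := by
  unfold factors
  simp only [Finset.mem_image, Finset.mem_product, Finset.mem_range, Prod.exists]
  constructor
  · rintro ⟨a, b, -, rfl⟩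
    exact (List.take_prefix _ _).isInfix.trans (List.drop_suffix _ _).isInfix
  · rintro ⟨s, t, rfl⟩
    refine ⟨s.length, u.length, ⟨?_, ?_⟩, ?_⟩
    · simp
    · simp; omega
    · simp

def Fac (w : List A) (n : ℕ) : Finset (List A) := (factors w).filter (fun u => u.length = n)

lemma mem_Fac (w u : List A) (n : ℕ) : u ∈ Fac w n ↔ u <:+: w ∧ u.length = n := by
  unfold Fac; rw [Finset.mem_filter, mem_factors']

def rext (w u : List A) : Finset A := (Alph w).filter (fun x => u ++ [x] <:+: w)

lemma mem_rext (w u : List A) (x : A) : x ∈ rext w u ↔ u ++ [x] <:+: w := by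
  unfold rext Alph
  rw [Finset.mem_filter]
  constructor
  · exact fun h => h.2
  · intro h
    refine ⟨?_, h⟩
    rw [List.mem_toFinset]
    exact h.subset (by simp)

def sp (w : List A) (n : ℕ) : ℕ := ∑ u ∈ Fac w n, ((rext w u).card - 1)

lemma rs_iff (w u : List A) : RightSpecial w u ↔ 2 ≤ (rext w u).card := by
  constructor
  · exact fun h => h.2
  · intro h
    refine ⟨?_, h⟩
    have : 0 < (rext w u).card := by omega
    obtain ⟨x, hx⟩ := Finset.card_pos.1 this
    rw [mem_rext] at hx
    exact (List.prefix_append u [x]).isInfix.trans hx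

lemma rext_mono (w u u' : List A) (h : u' <:+ u) : rext w u ⊆ rext w u' := by
  intro x hx
  rw [mem_rext] at *
  obtain ⟨t, rfl⟩ := h
  exact (List.IsSuffix.isInfix ⟨t, by simp⟩).trans hx

lemma sp_pos (w : List A) (n : ℕ) : 0 < sp w n ↔ ∃ u, u.length = n ∧ RightSpecial w u := by
  unfold sp
  rw [Finset.sum_pos_iff]
  constructor
  · rintro ⟨u, hu, h⟩
    rw [mem_Fac] at hu
    exact ⟨u, hu.2, (rs_iff w u).2 (by omega)⟩
  · rintro ⟨u, hu, h⟩
    refine ⟨u, (mem_Fac _ _ _).2 ⟨h.1, hu⟩, ?_⟩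
    rw [rs_iff] at h
    omega

lemma rs_len (w u : List A) (h : RightSpecial w u) : u.length < w.length := by
  rw [rs_iff] at h
  have : 0 < (rext w u).card := by omega
  obtain ⟨x, hx⟩ := Finset.card_pos.1 this
  rw [mem_rext] at hx
  have := hx.length_le
  simp at this
  omega

lemma R_set_ne (w : List A) :
    (w.length + 1) ∈ {r : ℕ | 0 < r ∧ ∀ u : List A, u.length = r → ¬ RightSpecial w u} := by
  refine ⟨by omega, fun u hu h => ?_⟩
  have := rs_len w u h
  omega

lemma R_le (w : List A) : R w ≤ w.length + 1 := Nat.sInf_le (R_set_ne w)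

lemma R_mem (w : List A) :
    R w ∈ {r : ℕ | 0 < r ∧ ∀ u : List A, u.length = r → ¬ RightSpecial w u} :=
  Nat.sInf_mem ⟨_, R_set_ne w⟩

lemma R_pos (w : List A) : 0 < R w := (R_mem w).1

lemma lt_R (w : List A) (n : ℕ) (hn : 0 < n) : n < R w ↔ 0 < sp w n := by
  rw [sp_pos]
  constructor
  · intro h
    by_contra hc
    push Not at hc
    have : R w ≤ n := Nat.sInf_le ⟨hn, hc⟩
    omega
  · rintro ⟨u, hu, h⟩
    by_contra hc
    have h2 := (R_mem w).2 (u.drop (n - R w)) (by simp; omega)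
    apply h2
    rw [rs_iff] at *
    exact h.trans (Finset.card_le_card (rext_mono w _ _ (List.drop_suffix _ _)))

lemma occ_iff (w u : List A) (hu : u <:+ w) : occCount w u = 1 ↔ rext w u = ∅ := by
  obtain ⟨t, rfl⟩ := hu
  unfold occCount
  set S := ((Finset.range ((t ++ u).length + 1)).filter
    (fun i => i + u.length ≤ (t ++ u).length ∧ ((t ++ u).drop i).take u.length = u)) with hS
  have h0 : t.length ∈ S := by
    rw [hS, Finset.mem_filter]
    simp
  constructor
  · intro h
    by_contra hc
    obtain ⟨x, hx⟩ := Finset.nonempty_iff_ne_empty.2 hc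
    rw [mem_rext] at hx
    obtain ⟨a, b, hab⟩ := hx
    have hl : a.length + (u.length + 1) + b.length = t.length + u.length := by
      have := congrArg List.length hab
      simp at this; omega
    have h1 : a.length ∈ S := by
      rw [hS, Finset.mem_filter]
      refine ⟨by simp; omega, by simp; omega, ?_⟩
      rw [← hab]
      simp
    have := Finset.card_le_one.1 h.le _ h0 _ h1
    omega
  · intro h
    rw [Finset.card_eq_one]
    refine ⟨t.length, ?_⟩
    ext i
    rw [Finset.mem_singleton]
    constructor
    · intro hi
      rw [hS, Finset.mem_filter] at hi
      obtain ⟨-, h1, h2⟩ := hi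
      by_contra hne
      have hlt : i + u.length < (t ++ u).length := by
        simp at h1 ⊢; omega
      have : (t ++ u)[i + u.length] ∈ rext (t ++ u) u := by
        rw [mem_rext]
        have e : u ++ [(t ++ u)[i + u.length]] = ((t ++ u).drop i).take (u.length + 1) := by
          rw [List.take_add_one, h2]
          congr 1
          rw [List.getElem?_drop, List.getElem?_eq_getElem hlt]
          rfl
        rw [e]
        exact (List.take_prefix _ _).isInfix.trans (List.drop_suffix _ _).isInfix
      rw [h] at this
      simp at this
    · rintro rfl
      exact h0

lemma rext_self (w : List A) : rext w w = ∅ := by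
  by_contra hc
  obtain ⟨x, hx⟩ := Finset.nonempty_iff_ne_empty.2 hc
  rw [mem_rext] at hx
  have := hx.length_le
  simp at this

lemma K_set_ne (w : List A) :
    w.length ∈ {k : ℕ | ∃ u : List A, u <:+ w ∧ u.length = k ∧ occCount w u = 1} :=
  ⟨w, List.suffix_rfl, rfl, (occ_iff w w List.suffix_rfl).2 (rext_self w)⟩

lemma K_le (w : List A) : K w ≤ w.length := Nat.sInf_le (K_set_ne w)

lemma K_mem (w : List A) :
    K w ∈ {k : ℕ | ∃ u : List A, u <:+ w ∧ u.length = k ∧ occCount w u = 1} :=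
  Nat.sInf_mem ⟨_, K_set_ne w⟩

lemma K_le_iff (w u : List A) (hu : u <:+ w) : K w ≤ u.length ↔ rext w u = ∅ := by
  constructor
  · intro h
    obtain ⟨u', h1, h2, h3⟩ := K_mem w
    rw [occ_iff w u' h1] at h3
    have : u' <:+ u := List.suffix_of_suffix_length_le h1 hu (by omega)
    have := rext_mono w u u' this
    rw [h3] at this
    exact Finset.subset_empty.1 this
  · intro h
    exact Nat.sInf_le ⟨u, hu, rfl, (occ_iff w u hu).2 h⟩

lemma K_pos (w : List A) (hw : w ≠ []) : 0 < K w := by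
  by_contra hc
  have := (K_le_iff w [] List.nil_suffix).1 (by simp; omega)
  obtain ⟨a, t, rfl⟩ := List.exists_cons_of_ne_nil hw
  have h2 : a ∈ rext (a :: t) [] := by
    rw [mem_rext]; exact ⟨[], t, by simp⟩
  rw [this] at h2
  simp at h2

lemma rext_ne (w u : List A) (hu : u <:+: w) (h : ¬ u <:+ w) : (rext w u).Nonempty := by
  obtain ⟨s, t, rfl⟩ := hu
  cases t with
  | nil => exact absurd ⟨s, by simp⟩ h
  | cons a t => exact ⟨a, (mem_rext _ _ _).2 ⟨s, t, by simp⟩⟩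

lemma C_succ (w : List A) (n : ℕ) : C w (n + 1) = ∑ u ∈ Fac w n, (rext w u).card := by
  have h1 : C w (n+1) = (Fac w (n+1)).card := rfl
  rw [h1, Finset.card_eq_sum_card_fiberwise (f := List.dropLast) (t := Fac w n)]
  · apply Finset.sum_congr rfl
    intro u hu
    rw [mem_Fac] at hu
    symm
    apply Finset.card_bij (fun x _ => u ++ [x])
    · intro x hx
      rw [mem_rext] at hx
      rw [Finset.mem_filter, mem_Fac]
      exact ⟨⟨hx, by simp [hu.2]⟩, by simp⟩
    · intro x _ y _ h
      simpa using h
    · intro b hb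
      rw [Finset.mem_filter, mem_Fac] at hb
      obtain ⟨⟨hb1, hb2⟩, hb3⟩ := hb
      have hne : b ≠ [] := by rintro rfl; simp at hb2
      have e := List.dropLast_append_getLast hne
      rw [hb3] at e
      exact ⟨b.getLast hne, by rw [mem_rext, e]; exact hb1, e⟩
  · intro u hu
    have hu' : u ∈ Fac w (n+1) := hu
    rw [mem_Fac] at hu'
    show u.dropLast ∈ Fac w n
    rw [mem_Fac]
    exact ⟨(List.dropLast_prefix u).isInfix.trans hu'.1, by simp [hu'.2]⟩

lemma C_rec (w : List A) (n : ℕ) (hn : n ≤ w.length) :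
    C w (n + 1) + (if K w ≤ n then 1 else 0) = C w n + sp w n := by
  rw [C_succ]
  have h1 : C w n = ∑ u ∈ Fac w n, 1 := by rw [Finset.sum_const, smul_eq_mul, mul_one]; rfl
  set z := w.drop (w.length - n) with hz
  have hzs : z <:+ w := List.drop_suffix _ _
  have hzl : z.length = n := by simp [hz]; omega
  have hzF : z ∈ Fac w n := (mem_Fac _ _ _).2 ⟨hzs.isInfix, hzl⟩
  have h2 : (if K w ≤ n then 1 else 0) = ∑ u ∈ Fac w n, if u = z ∧ K w ≤ n then 1 else 0 := by
    rw [Finset.sum_eq_single z]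
    · simp
    · intro b _ hb; simp [hb]
    · intro h; exact absurd hzF h
  rw [h1, h2, sp, ← Finset.sum_add_distrib, ← Finset.sum_add_distrib]
  apply Finset.sum_congr rfl
  intro u hu
  rw [mem_Fac] at hu
  have hk := K_le_iff w z hzs
  rw [hzl] at hk
  by_cases h : u = z
  · subst h
    by_cases h' : K w ≤ n
    · simp [h', hk.1 h']
    · have : 0 < (rext w z).card := by
        rw [Finset.card_pos]
        exact Finset.nonempty_iff_ne_empty.2 (fun h => h' (hk.2 h))
      simp [h']
      omega
  · have : 0 < (rext w u).card := by
      rw [Finset.card_pos]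
      apply rext_ne _ _ hu.1
      intro hs
      apply h
      have := List.suffix_of_suffix_length_le hs hzs (by omega)
      exact this.eq_of_length (by omega)
    simp [h]
    omega

lemma C_one (w : List A) : C w 1 = (Alph w).card := by
  rw [C_succ]
  have : Fac w 0 = {[]} := by
    ext u
    rw [mem_Fac, Finset.mem_singleton, List.length_eq_zero_iff]
    constructor
    · exact fun h => h.2
    · rintro rfl; exact ⟨List.nil_infix, rfl⟩
  rw [this, Finset.sum_singleton]
  congr 1
  ext x
  rw [mem_rext]
  unfold Alph
  simp [List.singleton_infix_iff]

lemma C_top (w : List A) : C w (w.length + 1) = 0 := by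
  have : C w (w.length + 1) = (Fac w (w.length+1)).card := rfl
  rw [this, Finset.card_eq_zero]
  ext u
  rw [mem_Fac]
  simp only [Finset.notMem_empty, iff_false]
  rintro ⟨h1, h2⟩
  have := h1.length_le
  omega

lemma C_reverse (w : List A) (n : ℕ) : C w.reverse n = C w n := by
  show (Fac w.reverse n).card = (Fac w n).card
  apply Finset.card_bij (fun u _ => u.reverse)
  · intro u hu
    rw [mem_Fac] at *
    refine ⟨?_, by simpa using hu.2⟩
    have := List.reverse_infix.2 hu.1
    simpa using this
  · intro u _ v _ h
    simpa using h
  · intro b hb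
    rw [mem_Fac] at hb
    exact ⟨b.reverse, (mem_Fac _ _ _).2 ⟨List.reverse_infix.2 hb.1, by simpa using hb.2⟩, by simp⟩

lemma L_eq (w : List A) : L w = R w.reverse := by
  have key : ∀ u, LeftSpecial w u ↔ RightSpecial w.reverse u.reverse := by
    intro u
    unfold LeftSpecial RightSpecial leftValence rightValence Alph
    rw [List.reverse_infix, List.toFinset_reverse]
    have : ∀ x, (u.reverse ++ [x] <:+: w.reverse) ↔ (x :: u <:+: w) := by
      intro x
      rw [← List.reverse_cons, List.reverse_infix]
    simp only [this]
  unfold L R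
  congr 1
  ext r
  simp only [Set.mem_ofPred_eq, key]
  apply and_congr_right
  intro _
  constructor
  · intro h u hu
    have := h u.reverse (by simpa using hu)
    simpa using this
  · intro h u hu
    exact h u.reverse (by simpa using hu)

lemma occ_rev (w u : List A) : occCount w.reverse u.reverse = occCount w u := by
  have key : ∀ (w u : List A) (i : ℕ), i + u.length ≤ w.length → (w.drop i).take u.length = u →
      (w.reverse.drop (w.length - u.length - i)).take u.length = u.reverse := by
    intro w u i hi h
    have e : w = w.take i ++ u ++ (w.drop i).drop u.length := by
      conv_lhs => rw [← List.take_append_drop i w, ← List.take_append_drop u.length (w.drop i), h]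
      simp
    have e2 : w.reverse = ((w.drop i).drop u.length).reverse ++ u.reverse ++ (w.take i).reverse := by
      conv_lhs => rw [e]
      simp only [List.reverse_append, List.append_assoc]
    have l : (((w.drop i).drop u.length).reverse).length = w.length - u.length - i := by
      simp; omega
    rw [e2, ← l, List.append_assoc, List.drop_left]
    have : u.length = u.reverse.length := by simp
    rw [this, List.take_left]
  unfold occCount
  symm
  apply Finset.card_bij (fun i _ => w.length - u.length - i)
  · intro i hi
    simp only [Finset.mem_filter, Finset.mem_range, List.length_reverse] at *
    exact ⟨by omega, by omega, key w u i hi.2.1 hi.2.2⟩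
  · intro i hi j hj
    simp only [Finset.mem_filter, Finset.mem_range] at *
    omega
  · intro j hj
    simp only [Finset.mem_filter, Finset.mem_range, List.length_reverse] at hj
    refine ⟨w.length - u.length - j, ?_, by omega⟩
    have := key w.reverse u.reverse j (by simpa using hj.2.1) (by simpa using hj.2.2)
    simp only [List.length_reverse, List.reverse_reverse] at this
    simp only [Finset.mem_filter, Finset.mem_range]
    exact ⟨by omega, by omega, this⟩

lemma H_eq (w : List A) : H w = K w.reverse := by
  unfold H K
  congr 1
  ext k
  simp only [Set.mem_ofPred_eq]
  constructor
  · rintro ⟨u, h1, h2, h3⟩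
    exact ⟨u.reverse, List.reverse_suffix.2 h1, by simpa using h2, by rw [occ_rev]; exact h3⟩
  · rintro ⟨u, h1, h2, h3⟩
    refine ⟨u.reverse, ?_, by simpa using h2, ?_⟩
    · rw [← List.reverse_suffix]; simpa using h1
    · rw [← occ_rev]; simpa using h3

lemma sum_eq (w : List A) (hw : w ≠ []) :
    ∑ n ∈ Finset.Icc 1 w.length, sp w n + K w + (Alph w).card = w.length + 1 := by
  have h1 : ∀ m, m ≤ w.length → C w (m+1) + ∑ n ∈ Finset.Icc 1 m, (if K w ≤ n then 1 else 0) =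
      C w 1 + ∑ n ∈ Finset.Icc 1 m, sp w n := by
    intro m
    induction m with
    | zero => simp
    | succ m ih =>
      intro hm
      have := ih (by omega)
      have h2 := C_rec w (m+1) hm
      rw [Finset.sum_Icc_succ_top (by omega), Finset.sum_Icc_succ_top (by omega)]
      omega
  have h2 : ∑ n ∈ Finset.Icc 1 w.length, (if K w ≤ n then 1 else 0) = w.length + 1 - K w := by
    rw [← Finset.sum_filter, Finset.sum_const, smul_eq_mul, mul_one]
    have : (Finset.Icc 1 w.length).filter (fun n => K w ≤ n) = Finset.Icc (K w) w.length := by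
      ext n
      have := K_pos w hw
      simp only [Finset.mem_filter, Finset.mem_Icc]
      omega
    rw [this, Nat.card_Icc]
  have h3 := h1 w.length le_rfl
  rw [h2, C_top, C_one] at h3
  have := K_le w
  omega

lemma sum_ind (w : List A) :
    ∑ n ∈ Finset.Icc 1 w.length, (if n < R w then 1 else 0) + 1 = R w := by
  rw [← Finset.sum_filter, Finset.sum_const, smul_eq_mul, mul_one]
  have h1 := R_pos w
  have h2 := R_le w
  have : (Finset.Icc 1 w.length).filter (fun n => n < R w) = Finset.Icc 1 (R w - 1) := by
    ext n
    simp only [Finset.mem_filter, Finset.mem_Icc]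
    omega
  rw [this, Nat.card_Icc]
  omega

lemma ind_le (w : List A) : ∀ n ∈ Finset.Icc 1 w.length, (if n < R w then 1 else 0) ≤ sp w n := by
  intro n hn
  rw [Finset.mem_Icc] at hn
  have := lt_R w n (by omega)
  split_ifs with h
  · exact this.1 h
  · omega

lemma ineq (w : List A) (hw : w ≠ []) : R w + K w + (Alph w).card ≤ w.length + 2 := by
  have h1 := sum_eq w hw
  have h2 := sum_ind w
  have h3 := Finset.sum_le_sum (ind_le w)
  omega

lemma eq_iff (w : List A) (hw : w ≠ []) : w.length + 2 = R w + K w + (Alph w).card ↔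
    ∀ n, 1 ≤ n → n ≤ w.length → sp w n = if n < R w then 1 else 0 := by
  have h1 := sum_eq w hw
  have h2 := sum_ind w
  have h3 := Finset.sum_eq_sum_iff_of_le (ind_le w)
  constructor
  · intro h n hn hn'
    exact (h3.1 (by omega) n (Finset.mem_Icc.2 ⟨hn, hn'⟩)).symm
  · intro h
    have := h3.2 (fun n hn => (h n (Finset.mem_Icc.1 hn).1 (Finset.mem_Icc.1 hn).2).symm)
    omega

lemma two_le_sp (w u u' : List A) (n : ℕ) (hne : u ≠ u') (hu : u.length = n) (hu' : u'.length = n)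
    (h : RightSpecial w u) (h' : RightSpecial w u') : 2 ≤ sp w n := by
  have hs : ({u, u'} : Finset (List A)) ⊆ Fac w n := by
    intro x hx
    rw [Finset.mem_insert, Finset.mem_singleton] at hx
    rw [mem_Fac]
    rcases hx with rfl | rfl
    · exact ⟨h.1, hu⟩
    · exact ⟨h'.1, hu'⟩
  have := Finset.sum_le_sum_of_subset (f := fun u => (rext w u).card - 1) hs
  rw [Finset.sum_pair hne] at this
  rw [rs_iff] at h h'
  unfold sp
  omega

lemma key (w : List A) (n : ℕ) (h1 : sp w n = 1) (h2 : 2 ≤ sp w (n+1)) :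
    2 ≤ sp w.reverse (n+1) := by
  have hcard : ∀ u, u.length = n → u <:+: w → (rext w u).card ≤ 2 := by
    intro u hu hi
    have : (rext w u).card - 1 ≤ sp w n :=
      Finset.single_le_sum (f := fun u => (rext w u).card - 1) (fun _ _ => Nat.zero_le _)
        ((mem_Fac _ _ _).2 ⟨hi, hu⟩)
    omega
  have htl : ∀ u, u.length = n + 1 → RightSpecial w u → RightSpecial w u.tail := by
    intro u hu h
    rw [rs_iff] at *
    exact h.trans (Finset.card_le_card (rext_mono w _ _ (List.tail_suffix u)))
  have hext : ∀ u, u.length = n + 1 → RightSpecial w u →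
      (rext w u).card = 2 ∧ rext w u = rext w u.tail := by
    intro u hu h
    have h' := htl u hu h
    have a := hcard u.tail (by simp [hu]) h'.1
    have b := Finset.card_le_card (rext_mono w _ _ (List.tail_suffix u))
    rw [rs_iff] at h
    exact ⟨by omega, Finset.eq_of_subset_of_card_le (rext_mono w _ _ (List.tail_suffix u)) (by omega)⟩
  have htwo : ∃ u u', u ≠ u' ∧ u.length = n+1 ∧ u'.length = n+1 ∧
      RightSpecial w u ∧ RightSpecial w u' := by
    have hle : sp w (n+1) ≤ ((Fac w (n+1)).filter (fun u => 2 ≤ (rext w u).card)).card := by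
      rw [Finset.card_filter]
      apply Finset.sum_le_sum
      intro u hu
      rw [mem_Fac] at hu
      split_ifs with h
      · have := (hext u hu.2 ((rs_iff _ _).2 h)).1
        omega
      · omega
    obtain ⟨u, hu, u', hu', hne⟩ := Finset.one_lt_card.1 (show 1 < _ by exact lt_of_lt_of_le h2 hle)
    rw [Finset.mem_filter, mem_Fac, ← rs_iff] at hu hu'
    exact ⟨u, u', hne, hu.1.2, hu'.1.2, hu.2, hu'.2⟩
  obtain ⟨u, u', hne, hu, hu', hr, hr'⟩ := htwo
  have htt : u.tail = u'.tail := by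
    by_contra hc
    have := two_le_sp w u.tail u'.tail n hc (by simp [hu]) (by simp [hu']) (htl u hu hr) (htl u' hu' hr')
    omega
  have e1 := hext u hu hr
  have e2 := (hext u' hu' hr').2
  rw [← htt, ← e1.2] at e2
  obtain ⟨a, b, hab, hset⟩ := Finset.card_eq_two.1 e1.1
  cases u with
  | nil => simp at hu
  | cons c q =>
  cases u' with
  | nil => simp at hu'
  | cons d q' =>
  simp only [List.tail_cons] at htt
  subst htt
  have hcd : c ≠ d := by rintro rfl; exact hne rfl
  have hspec : ∀ x, x ∈ rext w (c :: q) → RightSpecial w.reverse (x :: q.reverse) := by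
    intro x hx
    rw [rs_iff]
    have hx' := hx
    rw [← e2] at hx'
    rw [mem_rext] at hx hx'
    have : ({c, d} : Finset A) ⊆ rext w.reverse (x :: q.reverse) := by
      intro y hy
      rw [Finset.mem_insert, Finset.mem_singleton] at hy
      rw [mem_rext]
      rcases hy with rfl | rfl
      · have := List.reverse_infix.2 hx
        simpa using this
      · have := List.reverse_infix.2 hx'
        simpa using this
    have := Finset.card_le_card this
    rwa [Finset.card_pair hcd] at this
  refine two_le_sp w.reverse (a :: q.reverse) (b :: q.reverse) (n+1) ?_ (by simpa using hu)
    (by simpa using hu) (hspec a (by rw [hset]; simp)) (hspec b (by rw [hset]; simp))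
  intro h
  exact hab (by simpa using h)

lemma main_case (v : List A) (hv : v ≠ []) (hH : 2 ≤ H v)
    (h : v.length + 2 = R v + K v + (Alph v).card) :
    min (R v) (K v) = min (L v) (H v) ∧
    v.length + 2 = L v + H v + (Alph v).card := by
  have hv' : v.reverse ≠ [] := by simpa using hv
  have hA : Alph v.reverse = Alph v := by unfold Alph; exact List.toFinset_reverse
  have hlen : v.reverse.length = v.length := List.length_reverse
  have hE := (eq_iff v hv).1 h
  have hE' := eq_iff v.reverse hv'
  rw [← L_eq, ← H_eq, hA, hlen] at hE'
  have hrec : ∀ n, 1 ≤ n → n ≤ v.length → sp v.reverse n + (if K v ≤ n then 1 else 0) =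
      (if n < R v then 1 else 0) + (if H v ≤ n then 1 else 0) := by
    intro n h1 h2
    have a := C_rec v n h2
    have b := C_rec v.reverse n (by omega)
    rw [← H_eq, C_reverse, C_reverse] at b
    rw [← hE n h1 h2]
    omega
  have hL : ∀ n, 1 ≤ n → (n < L v ↔ 0 < sp v.reverse n) := by
    intro n hn
    rw [L_eq]; exact lt_R _ n (by omega)
  have hKp := K_pos v hv
  have hRp := R_pos v
  have hKl := K_le v
  have hLp : 0 < L v := by rw [L_eq]; exact R_pos _
  have hHl : H v ≤ v.length := by rw [H_eq, ← hlen]; exact K_le _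
  have hm : min (R v) (K v) ≤ H v := by
    by_contra hc
    have hc1 : H v < R v := by omega
    have hc2 : H v < K v := by omega
    have a := hrec (H v) (by omega) hHl
    have b := hrec (H v - 1) (by omega) (by omega)
    rw [if_neg (by omega), if_pos (by omega), if_pos (by omega)] at a
    rw [if_neg (by omega), if_pos (by omega), if_neg (by omega)] at b
    have e : H v - 1 + 1 = H v := by omega
    have k := key v.reverse (H v - 1) (by omega) (by rw [e]; omega)
    rw [e, List.reverse_reverse, hE (H v) (by omega) hHl, if_pos hc1] at k
    omega
  have hs : v.length + 2 = L v + H v + (Alph v).card := by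
    rw [hE']
    intro n h1 h2
    have a := hrec n h1 h2
    have b := hL n h1
    split_ifs at a ⊢ <;> omega
  refine ⟨?_, hs⟩
  have hLm : min (R v) (K v) ≤ L v := by
    by_cases h1 : min (R v) (K v) ≤ 1
    · omega
    have a := hrec (min (R v) (K v) - 1) (by omega) (by omega)
    have b := hL (min (R v) (K v) - 1) (by omega)
    rw [if_neg (by omega), if_pos (by omega)] at a
    omega
  have a := hrec (min (R v) (K v)) (by omega) (by omega)
  have b := hL (min (R v) (K v)) (by omega)
  split_ifs at a <;> omega

lemma nodup_case (v : List A) (hv : v ≠ []) (hn : v.Nodup)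
    (h : v.length + 2 = R v + K v + (Alph v).card) :
    min (R v) (K v) = min (L v) (H v) ∧
    v.length + 2 = L v + H v + (Alph v).card := by
  have hv' : v.reverse ≠ [] := by simpa using hv
  have hA : Alph v.reverse = Alph v := by unfold Alph; exact List.toFinset_reverse
  have hlen : v.reverse.length = v.length := List.length_reverse
  have hc : (Alph v).card = v.length := List.toFinset_card_of_nodup hn
  have a := ineq v.reverse hv'
  rw [← L_eq, ← H_eq, hA, hlen] at a
  have hKp := K_pos v hv
  have hRp := R_pos v
  have hLp : 0 < L v := by rw [L_eq]; exact R_pos _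
  have hHp : 0 < H v := by rw [H_eq]; exact K_pos _ hv'
  omega

lemma H_two (x : A) (t : List A) (hx : x ∈ t) : 2 ≤ H (x :: t) := by
  rw [H_eq]
  by_contra hc
  have hs : [x] <:+ (x :: t).reverse := by simp
  have := (K_le_iff _ _ hs).1 (by rw [List.length_singleton]; omega)
  obtain ⟨a, b, rfl⟩ := List.append_of_mem hx
  have : ∃ y, y ∈ rext (x :: (a ++ x :: b)).reverse [x] := by
    rcases List.eq_nil_or_concat (x :: a) with h | ⟨l, y, h⟩
    · simp at h
    · refine ⟨y, (mem_rext _ _ _).2 ?_⟩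
      rw [← List.cons_append, h]
      exact ⟨b.reverse, l.reverse, by simp⟩
  obtain ⟨y, hy⟩ := this
  simp_all

lemma decomp (r v s : List A) (hr : ∀ x ∈ r, (r ++ v ++ s).count x = 1)
    (hs : ∀ x ∈ s, (r ++ v ++ s).count x = 1) :
    (r ++ v ++ s).length + (Alph v).card = v.length + (Alph (r ++ v ++ s)).card := by
  have pos : ∀ (l : List A) x, x ∈ l → 0 < l.count x := fun l x h => List.count_pos_iff.2 h
  simp only [List.count_append] at hr hs
  have nr : r.Nodup := by
    rw [List.nodup_iff_count_le_one]
    intro x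
    by_cases h : x ∈ r
    · have := hr x h; omega
    · simp [List.count_eq_zero_of_not_mem h]
  have ns : s.Nodup := by
    rw [List.nodup_iff_count_le_one]
    intro x
    by_cases h : x ∈ s
    · have := hs x h; omega
    · simp [List.count_eq_zero_of_not_mem h]
  unfold Alph
  rw [List.toFinset_append, List.toFinset_append, Finset.card_union_of_disjoint,
    Finset.card_union_of_disjoint, List.toFinset_card_of_nodup nr, List.toFinset_card_of_nodup ns]
  · simp only [List.length_append]; omega
  · rw [Finset.disjoint_left]
    intro x h1 h2
    rw [List.mem_toFinset] at h1 h2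
    have := hr x h1
    have := pos _ _ h1
    have := pos _ _ h2
    omega
  · rw [Finset.disjoint_left]
    intro x h1 h2
    rw [Finset.mem_union, List.mem_toFinset, List.mem_toFinset] at h1
    rw [List.mem_toFinset] at h2
    have := hs x h2
    have := pos _ _ h2
    rcases h1 with h1 | h1
    · have := pos _ _ h1
      omega
    · have := pos _ _ h1
      omega

lemma heart_spec (w : List A) (hw : ¬ ∀ x ∈ w, w.count x = 1) :
    ∃ r s x t, w = r ++ (x :: t) ++ s ∧ heart w = x :: t ∧ (∀ y ∈ r, w.count y = 1) ∧
      (∀ y ∈ s, w.count y = 1) ∧ w.count x ≠ 1 := by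
  set p : A → Bool := fun x => w.count x == 1 with hp
  have hh : heart w = ((w.dropWhile p).reverse.dropWhile p).reverse := by
    unfold heart; rw [if_neg hw]
  have e1 : w = w.takeWhile p ++ w.dropWhile p := (List.takeWhile_append_dropWhile).symm
  set d := w.dropWhile p with hd
  have e2 : d.reverse = d.reverse.takeWhile p ++ d.reverse.dropWhile p :=
    (List.takeWhile_append_dropWhile).symm
  have e3 : d = heart w ++ (d.reverse.takeWhile p).reverse := by
    rw [hh, ← List.reverse_append, ← e2, List.reverse_reverse]
  have hr : ∀ y ∈ w.takeWhile p, w.count y = 1 := by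
    intro y hy
    simpa [hp] using List.mem_takeWhile_imp hy
  have hs : ∀ y ∈ (d.reverse.takeWhile p).reverse, w.count y = 1 := by
    intro y hy
    rw [List.mem_reverse] at hy
    simpa [hp] using List.mem_takeWhile_imp hy
  generalize hsd : (d.reverse.takeWhile p).reverse = s at *
  cases hc : heart w with
  | nil =>
    exfalso
    apply hw
    intro x hx
    rw [e1, e3, hc] at hx
    simp only [List.nil_append, List.mem_append] at hx
    rcases hx with hx | hx
    · exact hr x hx
    · exact hs x hx
  | cons x t =>
    refine ⟨w.takeWhile p, s, x, t, ?_, rfl, hr, hs, ?_⟩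
    · rw [hc] at e3
      rw [List.append_assoc, ← e3]; exact e1
    · have hne : w.dropWhile p ≠ [] := by rw [← hd, e3, hc]; simp
      have h1 := List.head_dropWhile_not p hne
      have h2 : (w.dropWhile p).head hne = x := by
        have : d.head? = some x := by rw [e3, hc]; rfl
        rw [hd, List.head?_eq_some_head hne] at this
        simpa using this
      rw [h2] at h1
      simpa [hp] using h1

theorem stmt5 (w : List A) (hw : w ≠ []) (v : List A) (hv : v = heart w)
    (h : w.length + 2 = R v + K v + (Alph w).card) :
    min (R v) (K v) = min (L v) (H v) ∧
    w.length + 2 = L v + H v + (Alph w).card := by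
  by_cases hu : ∀ x ∈ w, w.count x = 1
  · have : heart w = w := by unfold heart; rw [if_pos hu]
    rw [this] at hv
    subst hv
    apply nodup_case v hw _ h
    rw [List.nodup_iff_count_le_one]
    intro x
    by_cases hx : x ∈ v
    · exact (hu x hx).le
    · simp [List.count_eq_zero_of_not_mem hx]
  · obtain ⟨r, s, x, t, e, e2, hr, hs, hx⟩ := heart_spec w hu
    rw [e2] at hv
    rw [← hv] at e
    have hd := decomp r v s (by rw [← e]; exact hr) (by rw [← e]; exact hs)
    rw [← e] at hd
    have hxt : x ∈ t := by
      by_contra hc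
      apply hx
      have h1 : x ∉ r := fun h => hx (hr x h)
      have h2 : x ∉ s := fun h => hx (hs x h)
      rw [e, hv]
      simp [List.count_append, List.count_eq_zero_of_not_mem, h1, h2, hc]
    have hH : 2 ≤ H v := by rw [hv]; exact H_two x t hxt
    have := main_case v (by rw [hv]; simp) hH (by omega)
    exact ⟨this.1, by omega⟩
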